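/- Let N ≥ 2, T > 0, L ≥ 0, let p_1,…,p_N : closure(Q_T) → ℝ be Lipschitz continuous with p_i(z) > 2N/(N+2) and |∇_x p_i| ≤ L almost everywhere in Q_T, let ε ∈ (0,1), and let f be smooth on closure(Q_T) with f(·,t) = 0 on ∂K_a for every t ∈ [0,T]. Then for every ρ ∈ (0,1) there exists a constant C, depending on ρ, L, T, N, a and the bounds of the p_i but not on ε, u or f, such that every classical solution u of the regularized anisotropic equation satisfies: sup_{t∈(0,T)} ‖∇u(·,t)‖²_{2,K_a} + Σ_{i,j=1}^N ∫_{Q_T} (ε² + |D_i u|²)^{(p_i(z)−2)/2} (D²_{ij} u)² dz ≤ C ( 1 + Σ_{i=1}^N ∫_{Q_T} |D_i u|^{p_i(z)+ρ} dz + ‖∇u(·,0)‖²_{2,K_a} + ‖∇f‖²_{2,Q_T} ), where ∇ denotes the spatial gradient. -/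

import Mathlib

noncomputable section
open MeasureTheory Real

/-- The open parallelepiped `K_a = {x : |x_i| < a_i}`. -/
def Ka {N : ℕ} (a : Fin N → ℝ) : Set (Fin N → ℝ) := {x | ∀ i, |x i| < a i}

/-- The `i`-th partial derivative `D_i`. -/
def Dop {N : ℕ} (i : Fin N) (f : (Fin N → ℝ) → ℝ) : (Fin N → ℝ) → ℝ :=
  fun x => fderiv ℝ f x (Pi.single i 1)

section geometry

theorem Ka_eq_pi {N : ℕ} (a : Fin N → ℝ) :
    Ka a = Set.pi Set.univ (fun i => Set.Ioo (-a i) (a i)) := by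
  ext x; simp [Ka, abs_lt]

theorem isOpen_Ka {N : ℕ} (a : Fin N → ℝ) : IsOpen (Ka a) := by
  rw [Ka_eq_pi]; exact isOpen_set_pi Set.finite_univ (fun _ _ => isOpen_Ioo)

theorem mem_closure_Ka {N : ℕ} {a : Fin N → ℝ} (ha : ∀ i, 0 < a i) (x : Fin N → ℝ) :
    x ∈ closure (Ka a) ↔ ∀ i, |x i| ≤ a i := by
  rw [Ka_eq_pi, closure_pi_set]
  have : ∀ i, closure (Set.Ioo (-a i) (a i)) = Set.Icc (-a i) (a i) := fun i =>
    closure_Ioo (by have := ha i; linarith)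
  simp [this, abs_le, Pi.le_def, forall_and]

theorem closure_Ka_eq {N : ℕ} {a : Fin N → ℝ} (ha : ∀ i, 0 < a i) :
    closure (Ka a) = Set.Icc (-a) a := by
  ext x; rw [mem_closure_Ka ha]; simp [Set.mem_Icc, Pi.le_def, abs_le, forall_and]

theorem convex_Ka {N : ℕ} (a : Fin N → ℝ) : Convex ℝ (Ka a) := by
  rw [Ka_eq_pi]; exact convex_pi (fun i _ => convex_Ioo _ _)

theorem zero_mem_Ka {N : ℕ} {a : Fin N → ℝ} (ha : ∀ i, 0 < a i) : (0 : Fin N → ℝ) ∈ Ka a := by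
  intro i; simpa using ha i

theorem isCompact_cKa {N : ℕ} {a : Fin N → ℝ} (ha : ∀ i, 0 < a i) : IsCompact (closure (Ka a)) := by
  rw [closure_Ka_eq ha]; exact isCompact_Icc

theorem cKa_mem_nhds {N : ℕ} {a : Fin N → ℝ} {x : Fin N → ℝ} (hx : x ∈ Ka a) :
    closure (Ka a) ∈ nhds x :=
  Filter.mem_of_superset ((isOpen_Ka a).mem_nhds hx) subset_closure

theorem uniqueDiff_cKa {N : ℕ} {a : Fin N → ℝ} (ha : ∀ i, 0 < a i) :
    UniqueDiffOn ℝ (closure (Ka a)) :=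
  uniqueDiffOn_convex (convex_Ka a).closure
    ⟨0, mem_interior_iff_mem_nhds.2 (cKa_mem_nhds (zero_mem_Ka ha))⟩

theorem mem_frontier_Ka {N : ℕ} {a : Fin N → ℝ} {x : Fin N → ℝ} (hx : x ∈ closure (Ka a))
    {i : Fin N} (h : |x i| = a i) : x ∈ frontier (Ka a) := by
  rw [(isOpen_Ka a).frontier_eq]
  exact ⟨hx, fun hk => absurd (hk i) (by simp [h])⟩

theorem null_bdry {N : ℕ} (a : Fin N → ℝ) : volume (closure (Ka a) \ Ka a) = 0 := by
  rw [← (isOpen_Ka a).frontier_eq]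
  exact (convex_Ka a).addHaar_frontier volume

theorem measurable_Ka {N : ℕ} (a : Fin N → ℝ) : MeasurableSet (Ka a) := (isOpen_Ka a).measurableSet

theorem vol_Ka_lt {N : ℕ} {a : Fin N → ℝ} (ha : ∀ i, 0 < a i) : volume (Ka a) < ⊤ :=
  lt_of_le_of_lt (measure_mono subset_closure) (isCompact_cKa ha).measure_lt_top

theorem intOn_Ka {N : ℕ} {a : Fin N → ℝ} (ha : ∀ i, 0 < a i) {g : (Fin N → ℝ) → ℝ}
    (hg : ContinuousOn g (closure (Ka a))) : IntegrableOn g (Ka a) :=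
  (hg.integrableOn_compact (isCompact_cKa ha)).mono_set subset_closure

/-- directional derivative at a point where the function vanishes along a segment -/
theorem dir_zero {E : Type*} [NormedAddCommGroup E] [NormedSpace ℝ E] {S : Set E} {U : E → ℝ}
    {z d : E} (hU : DifferentiableWithinAt ℝ U S z)
    (h : ∀ τ ∈ Set.Icc (0 : ℝ) 1, z + τ • d ∈ S ∧ U (z + τ • d) = 0) :
    fderivWithin ℝ U S z d = 0 := by
  have h1 : HasDerivWithinAt (fun τ : ℝ => z + τ • d) d (Set.Icc 0 1) 0 := by
    have := ((hasDerivAt_id (0:ℝ)).smul_const d).const_add z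
    simpa using this.hasDerivWithinAt
  have h2 : HasFDerivWithinAt U (fderivWithin ℝ U S z) S ((fun τ : ℝ => z + τ • d) 0) := by
    simpa using hU.hasFDerivWithinAt
  have h3 := h2.comp_hasDerivWithinAt (0:ℝ) h1 (fun τ hτ => (h τ hτ).1)
  have h4 : HasDerivWithinAt (U ∘ fun τ : ℝ => z + τ • d) 0 (Set.Icc 0 1) 0 := by
    refine (hasDerivWithinAt_const (0:ℝ) (Set.Icc (0:ℝ) 1) (0:ℝ)).congr (fun τ hτ => (h τ hτ).2) ?_
    exact (h 0 (by simp)).2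
  exact (uniqueDiffOn_Icc (zero_lt_one) 0 (by simp)).eq_deriv _ h3 h4

/-- within partial derivative -/
def Dw {N : ℕ} (a : Fin N → ℝ) (i : Fin N) (v : (Fin N → ℝ) → ℝ) : (Fin N → ℝ) → ℝ :=
  fun x => fderivWithin ℝ v (closure (Ka a)) x (Pi.single i 1)

theorem Dw_smooth {N : ℕ} {a : Fin N → ℝ} (ha : ∀ i, 0 < a i) (i : Fin N) {v : (Fin N → ℝ) → ℝ}
    (hv : ContDiffOn ℝ (⊤ : ℕ∞) v (closure (Ka a))) :
    ContDiffOn ℝ (⊤ : ℕ∞) (Dw a i v) (closure (Ka a)) :=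
  (hv.fderivWithin (uniqueDiff_cKa ha) (by simp)).clm_apply contDiffOn_const

theorem Dw_eq_Dop {N : ℕ} {a : Fin N → ℝ} (i : Fin N) (v : (Fin N → ℝ) → ℝ) {x : Fin N → ℝ}
    (hx : x ∈ Ka a) : Dw a i v x = Dop i v x := by
  simp only [Dw, Dop]; rw [fderivWithin_of_mem_nhds (cKa_mem_nhds hx)]

theorem Dop_congr {N : ℕ} {a : Fin N → ℝ} (i : Fin N) {v w : (Fin N → ℝ) → ℝ}
    (h : ∀ x ∈ Ka a, v x = w x) {x : Fin N → ℝ}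
    (hx : x ∈ Ka a) : Dop i v x = Dop i w x := by
  simp only [Dop]
  rw [Filter.EventuallyEq.fderiv_eq (Filter.mem_of_superset ((isOpen_Ka a).mem_nhds hx) h)]

theorem Dw_face {N : ℕ} {a : Fin N → ℝ} (ha : ∀ i, 0 < a i) {i j : Fin N} (hij : i ≠ j)
    {v : (Fin N → ℝ) → ℝ} (hv : ContDiffOn ℝ (⊤ : ℕ∞) v (closure (Ka a)))
    (h0 : ∀ x ∈ closure (Ka a), |x j| = a j → v x = 0) :
    ∀ x ∈ closure (Ka a), |x j| = a j → Dw a i v x = 0 := by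
  intro x hx hxj
  obtain ⟨c, hc1, hc2⟩ : ∃ c : ℝ, c ≠ x i ∧ |c| ≤ a i := by
    by_cases h : x i = 0
    · exact ⟨a i, by rw [h]; exact (ha i).ne', by rw [abs_of_pos (ha i)]⟩
    · exact ⟨0, fun h' => h h'.symm, by simpa using (ha i).le⟩
  have hd : DifferentiableWithinAt ℝ v (closure (Ka a)) x :=
    (hv.differentiableOn (by simp)) x hx
  have key := dir_zero (d := (c - x i) • (Pi.single i 1 : Fin N → ℝ)) hd (by
    intro τ hτ
    have hmem : x + τ • (c - x i) • (Pi.single i 1 : Fin N → ℝ) ∈ closure (Ka a) := by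
      rw [mem_closure_Ka ha]
      intro k
      by_cases hk : k = i
      · subst hk
        have h1 := abs_le.1 ((mem_closure_Ka ha x).1 hx k)
        have h2 := abs_le.1 hc2
        simp only [Pi.add_apply, Pi.smul_apply, Pi.single_eq_same, smul_eq_mul, mul_one]
        rw [abs_le]
        constructor <;> nlinarith [hτ.1, hτ.2]
      · simpa [hk] using (mem_closure_Ka ha x).1 hx k
    refine ⟨hmem, h0 _ hmem ?_⟩
    simpa [hij.symm] using hxj)
  rw [map_smul, smul_eq_mul] at key
  exact (mul_eq_zero.1 key).resolve_left (sub_ne_zero.2 hc1)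

theorem lip_of_smooth {E : Type*} [NormedAddCommGroup E] [NormedSpace ℝ E] {S : Set E} {U : E → ℝ}
    (hS : IsCompact S) (hc : Convex ℝ S) (hu : UniqueDiffOn ℝ S)
    (hU : ContDiffOn ℝ (⊤ : ℕ∞) U S) : ∃ K : NNReal, LipschitzOnWith K U S := by
  have h1 : ContinuousOn (fderivWithin ℝ U S) S := hU.continuousOn_fderivWithin hu (by simp)
  obtain ⟨C, hC⟩ := hS.exists_bound_of_continuousOn h1
  refine ⟨C.toNNReal, Convex.lipschitzOnWith_of_nnnorm_fderivWithin_le (𝕜 := ℝ)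
    (hU.differentiableOn (by simp)) (fun x hx => ?_) hc⟩
  rw [← NNReal.coe_le_coe, coe_nnnorm]
  exact (hC x hx).trans (Real.le_coe_toNNReal C)

theorem ae_diff {N : ℕ} {a : Fin N → ℝ} {G : (Fin N → ℝ) → ℝ} {K : NNReal}
    (hG : LipschitzOnWith K G (closure (Ka a))) :
    ∀ᵐ x, x ∈ Ka a → DifferentiableAt ℝ G x := by
  filter_upwards [(hG.mono subset_closure : LipschitzOnWith K G (Ka a)).ae_differentiableWithinAt_of_mem
    (μ := volume)] with x hx hxk
  exact (hx hxk).differentiableAt ((isOpen_Ka a).mem_nhds hxk)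

theorem int_Dop {N : ℕ} {a : Fin N → ℝ} (ha : ∀ i, 0 < a i) {F h : (Fin N → ℝ) → ℝ} {K : NNReal}
    (hF : LipschitzOnWith K F (closure (Ka a))) (hh : ContinuousOn h (closure (Ka a))) (j : Fin N) :
    IntegrableOn (fun x => Dop j F x * h x) (Ka a) := by
  have h1 := intOn_Ka ha hh
  refine Integrable.bdd_mul h1 (c := K) ?_ ?_
  · exact (measurable_fderiv_apply_const ℝ F _).aestronglyMeasurable
  · refine (ae_restrict_iff' (measurable_Ka a)).2 (Filter.Eventually.of_forall fun x hx => ?_)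
    have h2 := norm_fderiv_le_of_lipschitzOn ℝ (cKa_mem_nhds hx) hF
    calc ‖Dop j F x‖ ≤ ‖fderiv ℝ F x‖ * ‖(Pi.single j 1 : Fin N → ℝ)‖ := by
          simpa only [Dop] using ContinuousLinearMap.le_opNorm _ _
      _ ≤ K * 1 := by
          gcongr
          rw [Pi.norm_single]; simp
      _ = K := mul_one _

end geometry

theorem lem_A_bound {N : ℕ} {a : Fin N → ℝ} (ha : ∀ i, 0 < a i) {G : (Fin N → ℝ) → ℝ} {K : NNReal}
    (hG : LipschitzOnWith K G (closure (Ka a))) (j : Fin N)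
    (h0 : ∀ x ∈ closure (Ka a), |x j| = a j → G x = 0) (x : Fin N → ℝ) (h : ℝ)
    (hx : x ∈ closure (Ka a)) (hxh : x + h • (Pi.single j 1 : Fin N → ℝ) ∉ closure (Ka a)) :
    |G x| ≤ K * |h| := by
  rw [mem_closure_Ka ha] at hxh
  push Not at hxh
  obtain ⟨k, hk⟩ := hxh
  have hxk := (mem_closure_Ka ha x).1 hx
  have hkj : k = j := by
    by_contra hne
    have := hxk k
    simp [hne] at hk
    linarith
  subst hkj
  simp only [Pi.add_apply, Pi.smul_apply, Pi.single_eq_same, smul_eq_mul, mul_one] at hk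
  obtain ⟨c, hc, hc2⟩ : ∃ c : ℝ, |c| = a k ∧ |x k - c| ≤ |h| := by
    have h1 := abs_le.1 (hxk k)
    have hak := ha k
    rcases lt_abs.1 hk with hp | hn
    · refine ⟨a k, abs_of_pos hak, ?_⟩
      rw [abs_le]; constructor <;> linarith [le_abs_self h, neg_abs_le h]
    · refine ⟨-a k, by rw [abs_neg, abs_of_pos hak], ?_⟩
      rw [abs_le]; constructor <;> linarith [le_abs_self h, neg_abs_le h]
  have hy : Function.update x k c ∈ closure (Ka a) := by
    rw [mem_closure_Ka ha]; intro l
    by_cases hl : l = k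
    · subst hl; simp [hc]
    · simpa [hl] using hxk l
  have hG0 : G (Function.update x k c) = 0 := h0 _ hy (by simp [hc])
  have h3 := hG.dist_le_mul x hx _ hy
  rw [hG0, Real.dist_eq, sub_zero] at h3
  refine h3.trans ?_
  gcongr
  rw [dist_pi_le_iff (abs_nonneg h)]
  intro l
  by_cases hl : l = k
  · subst hl; simpa [Real.dist_eq] using hc2
  · simp [hl]

theorem lem_A {N : ℕ} {a : Fin N → ℝ} (ha : ∀ i, 0 < a i) {G : (Fin N → ℝ) → ℝ} {K : NNReal}
    (hG : LipschitzOnWith K G (closure (Ka a))) (j : Fin N)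
    (h0 : ∀ x ∈ closure (Ka a), |x j| = a j → G x = 0) :
    ∫ x in Ka a, Dop j G x = 0 := by
  set X := closure (Ka a) with hX
  set e : Fin N → ℝ := Pi.single j 1 with he
  set H : (Fin N → ℝ) → ℝ := X.indicator G with hH
  have hXm : MeasurableSet X := isClosed_closure.measurableSet
  have hHint : Integrable H := by
    rw [hH, integrable_indicator_iff hXm]
    exact hG.continuousOn.integrableOn_compact (isCompact_cKa ha)
  have hHb : ∀ x h, |H (x + h • e) - H x| ≤ K * |h| := by
    intro x h
    by_cases hx : x ∈ X <;> by_cases hy : x + h • e ∈ X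
    · simp only [hH, Set.indicator_of_mem hx, Set.indicator_of_mem hy]
      have := hG.dist_le_mul _ hy _ hx
      rw [Real.dist_eq] at this
      refine this.trans ?_
      have : dist (x + h • e) x = |h| := by
        rw [dist_eq_norm, add_sub_cancel_left, norm_smul, he, Pi.norm_single]; simp
      rw [this]
    · simp only [hH, Set.indicator_of_mem hx, Set.indicator_of_notMem hy, zero_sub, abs_neg]
      exact lem_A_bound ha hG j h0 x h hx hy
    · simp only [hH, Set.indicator_of_notMem hx, Set.indicator_of_mem hy, sub_zero]
      have := lem_A_bound ha hG j h0 (x + h • e) (-h) hy (by simpa [he] using hx)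
      simpa using this
    · simp [hH, hx, hy]
      positivity
  -- the sequence of difference quotients
  set c : ℕ → ℝ := fun n => (n : ℝ) + 1 with hc
  have hcpos : ∀ n, 0 < c n := fun n => by simp only [hc]; positivity
  have hc1 : ∀ n, (c n)⁻¹ ≤ 1 := fun n => by
    apply inv_le_one_of_one_le₀; simp [hc]
  have hctop : Filter.Tendsto c Filter.atTop Filter.atTop :=
    Filter.tendsto_atTop_add_const_right _ _ tendsto_natCast_atTop_atTop
  set B : Set (Fin N → ℝ) := Metric.cthickening 1 X with hB
  have hBc : IsCompact B := (isCompact_cKa ha).cthickening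
  have hlim := tendsto_integral_of_dominated_convergence (μ := volume)
    (F := fun n x => c n • (H (x + (c n)⁻¹ • e) - H x)) (f := (Ka a).indicator (Dop j G))
    (B.indicator (fun _ => (K : ℝ)))
    (fun n => (((hHint.comp_add_right ((c n)⁻¹ • e)).sub hHint).smul (c n)).aestronglyMeasurable)
    (by
      rw [integrable_indicator_iff hBc.measurableSet]
      exact (continuousOn_const).integrableOn_compact hBc)
    (by
      intro n
      refine Filter.Eventually.of_forall fun x => ?_
      by_cases hx : x ∈ B
      · rw [Set.indicator_of_mem hx, norm_smul, Real.norm_eq_abs, Real.norm_eq_abs,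
          abs_of_pos (hcpos n)]
        have := hHb x (c n)⁻¹
        rw [abs_of_pos (inv_pos.2 (hcpos n))] at this
        calc c n * _ ≤ c n * (K * (c n)⁻¹) := by gcongr
          _ = K := by field_simp [(hcpos n).ne']
      · have h1 : x ∉ X := fun h => hx (Metric.self_subset_cthickening X h)
        have h2 : x + (c n)⁻¹ • e ∉ X := by
          intro h
          apply hx
          refine Metric.mem_cthickening_of_dist_le x _ 1 X h ?_
          rw [dist_comm, dist_eq_norm, add_sub_cancel_left, norm_smul, he, Pi.norm_single]
          simpa [abs_of_pos (hcpos n)] using hc1 n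
        simp [hH, h1, h2, hx])
    (by
      have hnull : ∀ᵐ x, x ∉ X \ Ka a := measure_eq_zero_iff_ae_notMem.1 (null_bdry a)
      filter_upwards [ae_diff hG, hnull] with x hx1 hx2
      by_cases hx : x ∈ Ka a
      · rw [Set.indicator_of_mem hx]
        have hHd : HasFDerivAt H (fderiv ℝ G x) x := by
          refine (hx1 hx).hasFDerivAt.congr_of_eventuallyEq ?_
          filter_upwards [cKa_mem_nhds hx] with y hy
          simp only [hH]; rw [Set.indicator_of_mem hy]
        exact (hHd.lim_real e).comp hctop
      · rw [Set.indicator_of_notMem hx]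
        have hxX : x ∉ X := fun h => hx2 ⟨h, hx⟩
        have hHd : HasFDerivAt H (0 : (Fin N → ℝ) →L[ℝ] ℝ) x := by
          refine (hasFDerivAt_const (0:ℝ) x).congr_of_eventuallyEq ?_
          filter_upwards [isClosed_closure.isOpen_compl.mem_nhds hxX] with y hy
          simp only [hH]; rw [Set.indicator_of_notMem hy]
        have h5 := (hHd.lim_real e).comp hctop
        exact h5)
  have hz : ∀ n, ∫ x, c n • (H (x + (c n)⁻¹ • e) - H x) = 0 := by
    intro n
    rw [integral_smul, integral_sub (hHint.comp_add_right _) hHint, integral_add_right_eq_self]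
    simp
  simp only [hz] at hlim
  have := tendsto_nhds_unique hlim tendsto_const_nhds
  rwa [integral_indicator (measurable_Ka a)] at this

theorem lem_B {N : ℕ} {a : Fin N → ℝ} (ha : ∀ i, 0 < a i) {F h : (Fin N → ℝ) → ℝ} {K : NNReal}
    (hF : LipschitzOnWith K F (closure (Ka a))) (hh : ContDiffOn ℝ (⊤ : ℕ∞) h (closure (Ka a)))
    (j : Fin N)
    (h0 : ∀ x ∈ closure (Ka a), |x j| = a j → F x * h x = 0) :
    ∫ x in Ka a, Dop j F x * h x = - ∫ x in Ka a, F x * Dop j h x := by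
  obtain ⟨K', hK'⟩ := lip_of_smooth (isCompact_cKa ha) (convex_Ka a).closure (uniqueDiff_cKa ha) hh
  obtain ⟨C1, hC1⟩ := (isCompact_cKa ha).exists_bound_of_continuousOn hF.continuousOn
  obtain ⟨C2, hC2⟩ := (isCompact_cKa ha).exists_bound_of_continuousOn hh.continuousOn
  have hGl : LipschitzOnWith (C1.toNNReal * K' + C2.toNNReal * K) (fun x => F x * h x)
      (closure (Ka a)) := by
    refine LipschitzOnWith.of_dist_le_mul fun x hx y hy => ?_
    have e1 := hF.dist_le_mul x hx y hy
    have e2 := hK'.dist_le_mul x hx y hy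
    have e3 := (hC1 x hx).trans (Real.le_coe_toNNReal C1)
    have e4 := (hC2 y hy).trans (Real.le_coe_toNNReal C2)
    rw [Real.dist_eq] at *
    rw [Real.norm_eq_abs] at *
    calc |F x * h x - F y * h y| = |F x * (h x - h y) + h y * (F x - F y)| := by ring_nf
      _ ≤ |F x| * |h x - h y| + |h y| * |F x - F y| := by
          refine (abs_add_le _ _).trans ?_
          rw [abs_mul, abs_mul]
      _ ≤ C1.toNNReal * (K' * dist x y) + C2.toNNReal * (K * dist x y) := by
          gcongr
      _ = _ := by push_cast; ring
  have hA := lem_A ha hGl j h0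
  have hI1 := int_Dop ha hF hh.continuousOn j
  have hI2 := int_Dop ha hK' hF.continuousOn j
  have : ∫ x in Ka a, Dop j (fun x => F x * h x) x =
      ∫ x in Ka a, (Dop j F x * h x + Dop j h x * F x) := by
    refine setIntegral_congr_ae (measurable_Ka a) ?_
    filter_upwards [ae_diff hF, ae_diff hK'] with x h1 h2 hx
    simp only [Dop]
    rw [fderiv_fun_mul (h1 hx) (h2 hx)]
    simp
    ring
  rw [this, integral_add hI1 hI2] at hA
  have h3 : ∫ x in Ka a, F x * Dop j h x = ∫ x in Ka a, Dop j h x * F x := by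
    simp only [mul_comm]
  rw [h3]; linarith

theorem Dw_symm {N : ℕ} {a : Fin N → ℝ} (i j : Fin N)
    {v : (Fin N → ℝ) → ℝ} (hv : ContDiffOn ℝ (⊤ : ℕ∞) v (closure (Ka a))) {x : Fin N → ℝ}
    (hx : x ∈ Ka a) : Dop i (Dop j v) x = Dop j (Dop i v) x := by
  have h1 : ContDiffAt ℝ (⊤ : ℕ∞) v x := hv.contDiffAt (cKa_mem_nhds hx)
  have h2 : DifferentiableAt ℝ (fderiv ℝ v) x :=
    (h1.fderiv_right (m := (⊤ : ℕ∞)) (by simp)).differentiableAt (by simp)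
  have h3 := h1.isSymmSndFDerivAt (by
    rw [minSmoothness_of_isRCLikeNormedField]
    exact WithTop.coe_le_coe.2 (le_top : (2 : ℕ∞) ≤ ⊤))
  have key : ∀ i j : Fin N, Dop i (Dop j v) x =
      fderiv ℝ (fderiv ℝ v) x (Pi.single i 1) (Pi.single j 1) := by
    intro i j
    simp only [Dop]
    unfold Dop
    rw [fderiv_clm_apply h2 (differentiableAt_const _)]
    simp
  rw [key, key]; exact h3 _ _


theorem log_bound (ρ : ℝ) (hρ : 0 < ρ) (hρ1 : ρ < 1) (M : ℝ) : ∃ C : ℝ, 0 < C ∧ ∀ ε ∈ Set.Ioo (0:ℝ) 1,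
    ∀ q P : ℝ, 1 ≤ P → P ≤ M →
    (ε ^ 2 + q ^ 2) ^ ((P - 2) / 2) * q ^ 2 * (Real.log (ε ^ 2 + q ^ 2)) ^ 2 ≤
      C * (1 + |q| ^ (P + ρ)) := by
  refine ⟨16 + 16 / ρ ^ 2 * 2 ^ ((M + 1) / 2), by positivity, ?_⟩
  intro ε hε q P hP hPM
  set r := ε ^ 2 + q ^ 2 with hr
  have hε2 : 0 < ε ^ 2 := by have := hε.1; positivity
  have hε1 : ε ^ 2 ≤ 1 := by nlinarith [hε.1, hε.2]
  have hr0 : 0 < r := by positivity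
  have hqr : q ^ 2 ≤ r := by linarith
  have hA : 0 ≤ |q| ^ (P + ρ) := by positivity
  have h1 : r ^ ((P - 2) / 2) * q ^ 2 ≤ r ^ (P / 2) := by
    calc r ^ ((P - 2) / 2) * q ^ 2 ≤ r ^ ((P - 2) / 2) * r := by gcongr
      _ = r ^ (P / 2) := by
        nth_rewrite 2 [← Real.rpow_one r]
        rw [← Real.rpow_add hr0]; congr 1; ring
  have h2 : r ^ ((P - 2) / 2) * q ^ 2 * (Real.log r) ^ 2 ≤ r ^ (P / 2) * (Real.log r) ^ 2 := by
    gcongr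
  refine h2.trans ?_
  rcases le_total r 1 with hr1 | hr1
  · have h3 := Real.abs_log_mul_self_rpow_lt r (1/4) hr0 hr1 (by norm_num)
    have h4 : r ^ (P / 2) ≤ r ^ ((1:ℝ)/4) * r ^ ((1:ℝ)/4) := by
      rw [← Real.rpow_add hr0]
      exact Real.rpow_le_rpow_of_exponent_ge hr0 hr1 (by linarith)
    have h5 : (Real.log r * r ^ ((1:ℝ)/4)) ^ 2 ≤ 16 := by
      rw [← sq_abs]
      have := abs_nonneg (Real.log r * r ^ ((1:ℝ)/4))
      norm_num at h3 this ⊢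
      nlinarith
    have h6 : r ^ (P / 2) * (Real.log r) ^ 2 ≤ 16 := by
      refine le_trans ?_ h5
      calc _ ≤ (r ^ ((1:ℝ)/4) * r ^ ((1:ℝ)/4)) * (Real.log r) ^ 2 := by gcongr
        _ = _ := by ring
    have h7 : 0 ≤ 16 / ρ ^ 2 * (2:ℝ) ^ ((M + 1) / 2) := by positivity
    nlinarith
  · have hl : Real.log r ≤ r ^ (ρ / 4) / (ρ / 4) := Real.log_le_rpow_div hr0.le (by linarith)
    have hl0 : 0 ≤ Real.log r := Real.log_nonneg hr1
    have h3 : (Real.log r) ^ 2 ≤ 16 / ρ ^ 2 * r ^ (ρ / 2) := by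
      calc (Real.log r) ^ 2 ≤ (r ^ (ρ / 4) / (ρ / 4)) ^ 2 := by gcongr
        _ = 16 / ρ ^ 2 * (r ^ (ρ / 4) * r ^ (ρ / 4)) := by field_simp; ring
        _ = _ := by rw [← Real.rpow_add hr0]; congr 2; ring
    have h4 : r ^ (P / 2) * (Real.log r) ^ 2 ≤ 16 / ρ ^ 2 * r ^ ((P + ρ) / 2) := by
      calc _ ≤ r ^ (P / 2) * (16 / ρ ^ 2 * r ^ (ρ / 2)) := by gcongr
        _ = 16 / ρ ^ 2 * (r ^ (P / 2) * r ^ (ρ / 2)) := by ring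
        _ = _ := by rw [← Real.rpow_add hr0]; congr 2; ring
    have h5 : r ^ ((P + ρ) / 2) ≤ 2 ^ ((M + 1) / 2) * (1 + |q| ^ (P + ρ)) := by
      have hmax : r ≤ 2 * max 1 (q ^ 2) := by
        have := le_max_left 1 (q^2); have := le_max_right 1 (q^2); linarith
      calc r ^ ((P + ρ) / 2) ≤ (2 * max 1 (q ^ 2)) ^ ((P + ρ) / 2) := by gcongr
        _ = 2 ^ ((P + ρ) / 2) * (max 1 (q ^ 2)) ^ ((P + ρ) / 2) := by
            rw [Real.mul_rpow (by norm_num) (by positivity)]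
        _ ≤ 2 ^ ((M + 1) / 2) * (1 + |q| ^ (P + ρ)) := by
            gcongr
            · norm_num
            · rcases max_choice 1 (q ^ 2) with hm | hm
              · rw [hm, Real.one_rpow]; linarith
              · rw [hm, ← sq_abs, ← Real.rpow_natCast, ← Real.rpow_mul (abs_nonneg q)]
                have : ((2:ℕ):ℝ) * ((P + ρ) / 2) = P + ρ := by push_cast; ring
                rw [this]; linarith
    calc _ ≤ 16 / ρ ^ 2 * r ^ ((P + ρ) / 2) := h4
      _ ≤ 16 / ρ ^ 2 * (2 ^ ((M + 1) / 2) * (1 + |q| ^ (P + ρ))) := by gcongr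
      _ ≤ _ := by nlinarith

theorem F_lip {N : ℕ} {a : Fin N → ℝ} (ha : ∀ i, 0 < a i) {ε : ℝ} (hε : 0 < ε)
    {q P : (Fin N → ℝ) → ℝ} {K1 K2 : NNReal}
    (hq : LipschitzOnWith K1 q (closure (Ka a))) (hP : LipschitzOnWith K2 P (closure (Ka a))) :
    ∃ K : NNReal, LipschitzOnWith K (fun y => (ε ^ 2 + q y ^ 2) ^ ((P y - 2) / 2) * q y)
      (closure (Ka a)) := by
  have hΦ : ContDiff ℝ 1 (fun y : ℝ × ℝ => (ε ^ 2 + y.1 ^ 2) ^ ((y.2 - 2) / 2) * y.1) := by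
    have h1 : ContDiff ℝ 1 (fun y : ℝ × ℝ => ε ^ 2 + y.1 ^ 2) := by fun_prop
    have h2 : ContDiff ℝ 1 (fun y : ℝ × ℝ => (y.2 - 2) / 2) := (contDiff_snd.sub contDiff_const).div_const 2
    have h3 : ∀ y : ℝ × ℝ, ε ^ 2 + y.1 ^ 2 ≠ 0 := fun y => by positivity
    exact (h1.rpow h2 h3).mul contDiff_fst
  have hc : IsCompact ((fun x => (q x, P x)) '' closure (Ka a)) :=
    (isCompact_cKa ha).image_of_continuousOn (hq.continuousOn.prodMk hP.continuousOn)
  obtain ⟨K, hK⟩ := (hΦ.locallyLipschitz.locallyLipschitzOn).exists_lipschitzOnWith_of_compact hc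
  have hp : LipschitzOnWith (max K1 K2) (fun x => (q x, P x)) (closure (Ka a)) := hq.prodMk hP
  refine ⟨K * max K1 K2, fun x hx y hy => ?_⟩
  have h1 := hK (Set.mem_image_of_mem _ hx) (Set.mem_image_of_mem _ hy)
  have h2 := hp hx hy
  refine h1.trans ?_
  rw [ENNReal.coe_mul, mul_assoc]
  gcongr

theorem DP_le {N : ℕ} {a : Fin N → ℝ} {L : ℝ} {P : (Fin N → ℝ) → ℝ}
    (hPx : ∀ x ∈ closure (Ka a), ∀ y ∈ closure (Ka a),
      |P x - P y| ≤ L * Real.sqrt (∑ j, (x j - y j) ^ 2)) {x : Fin N → ℝ} (hx : x ∈ Ka a)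
    (hd : DifferentiableAt ℝ P x) (i : Fin N) : |Dop i P x| ≤ L := by
  have h1 := hd.hasFDerivAt.lim_real (Pi.single i 1)
  have h2 : Filter.Tendsto (fun c : ℝ => x + c⁻¹ • (Pi.single i 1 : Fin N → ℝ)) Filter.atTop (nhds x) := by
    have := (tendsto_inv_atTop_zero (𝕜 := ℝ)).smul_const (Pi.single i 1 : Fin N → ℝ)
    simpa using this.const_add x
  refine le_of_tendsto h1.abs ?_
  filter_upwards [h2 (cKa_mem_nhds hx), Filter.eventually_gt_atTop 0] with c hc hc0
  have h3 := hPx _ hc x (subset_closure hx)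
  have h4 : Real.sqrt (∑ j, ((x + c⁻¹ • (Pi.single i 1 : Fin N → ℝ)) j - x j) ^ 2) = c⁻¹ := by
    rw [Finset.sum_eq_single i]
    · simp [Real.sqrt_sq hc0.le]
    · intro b _ hb; simp [hb]
    · simp
  rw [h4] at h3
  rw [smul_eq_mul, abs_mul, abs_of_pos hc0]
  calc c * _ ≤ c * (L * c⁻¹) := by gcongr
    _ = L := by field_simp

theorem pointwise {N : ℕ} {ε : ℝ} (hε : 0 < ε) {L m : ℝ} (hm : 0 < m) (hm1 : m ≤ 1)
    {q P : (Fin N → ℝ) → ℝ} {x : Fin N → ℝ} (hq : DifferentiableAt ℝ q x)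
    (hP : DifferentiableAt ℝ P x) (i : Fin N) (hL : |Dop i P x| ≤ L) (hPm : 1 + m ≤ P x) :
    (m / 2) * ((ε ^ 2 + q x ^ 2) ^ ((P x - 2) / 2) * (Dop i q x) ^ 2) -
      L ^ 2 / (8 * m) * ((ε ^ 2 + q x ^ 2) ^ ((P x - 2) / 2) * q x ^ 2 *
        (Real.log (ε ^ 2 + q x ^ 2)) ^ 2) ≤
    Dop i (fun y => (ε ^ 2 + q y ^ 2) ^ ((P y - 2) / 2) * q y) x * Dop i q x := by
  have hr0 : 0 < ε ^ 2 + q x ^ 2 := by positivity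
  have hf : HasFDerivAt (fun y => ε ^ 2 + q y ^ 2) ((2 * q x) • fderiv ℝ q x) x := by
    have := (hq.hasFDerivAt.pow 2).const_add (ε ^ 2)
    simpa using this
  have hg : HasFDerivAt (fun y => (P y - 2) / 2) ((1/2 : ℝ) • fderiv ℝ P x) x := by
    have := (hP.hasFDerivAt.sub_const 2).const_smul (1/2 : ℝ)
    refine this.congr_of_eventuallyEq (Filter.Eventually.of_forall fun y => ?_)
    simp; ring
  have hF := (hf.rpow hg hr0).mul hq.hasFDerivAt
  have hD : Dop i (fun y => (ε ^ 2 + q y ^ 2) ^ ((P y - 2) / 2) * q y) x =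
      (ε ^ 2 + q x ^ 2) ^ ((P x - 2) / 2) * Dop i q x + q x *
      ((P x - 2) / 2 * (ε ^ 2 + q x ^ 2) ^ ((P x - 2) / 2 - 1) * (2 * q x * Dop i q x) +
       (ε ^ 2 + q x ^ 2) ^ ((P x - 2) / 2) * Real.log (ε ^ 2 + q x ^ 2) * (1 / 2 * Dop i P x)) := by
    unfold Dop
    have h9 := hF.fderiv
    have h10 : ((fun y => (ε ^ 2 + q y ^ 2) ^ ((P y - 2) / 2)) * q) =
      (fun y => (ε ^ 2 + q y ^ 2) ^ ((P y - 2) / 2) * q y) := rfl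
    rw [h10] at h9
    rw [h9]
    simp
    ring
  rw [hD, Real.rpow_sub_one hr0.ne']
  set r := ε ^ 2 + q x ^ 2 with hr
  set w := r ^ ((P x - 2) / 2) with hw
  have hw0 : 0 ≤ w := by positivity
  set θ := q x ^ 2 / r with hθ
  have hθ0 : 0 ≤ θ := by positivity
  have hθ1 : θ ≤ 1 := by rw [hθ, div_le_one hr0]; have := sq_nonneg ε; linarith
  set D := Dop i q x
  set Q := q x
  set l := Real.log r
  set B := Dop i P x
  have e1 : (w * D + Q * ((P x - 2) / 2 * (w / r) * (2 * Q * D) + w * l * (1 / 2 * B))) * D =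
      w * ((1 + (P x - 2) * θ) * D ^ 2 + Q * l * B / 2 * D) := by
    rw [hθ]; field_simp; ring
  rw [e1]
  have e2 : m / 2 * (w * D ^ 2) - L ^ 2 / (8 * m) * (w * Q ^ 2 * l ^ 2) =
      w * (m / 2 * D ^ 2 - L ^ 2 / (8 * m) * (Q ^ 2 * l ^ 2)) := by ring
  rw [e2]
  refine mul_le_mul_of_nonneg_left ?_ hw0
  have e3 : m ≤ 1 + (P x - 2) * θ := by nlinarith
  have e4 : m * D ^ 2 ≤ (1 + (P x - 2) * θ) * D ^ 2 := by gcongr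
  have e5 : B ^ 2 ≤ L ^ 2 := by rw [← sq_abs B]; gcongr
  have e6 : 0 ≤ m / 2 * D ^ 2 + Q * l * B / 2 * D + B ^ 2 / (8 * m) * (Q ^ 2 * l ^ 2) := by
    have : m / 2 * D ^ 2 + Q * l * B / 2 * D + B ^ 2 / (8 * m) * (Q ^ 2 * l ^ 2) =
      1 / (8 * m) * (2 * m * D + Q * l * B) ^ 2 := by field_simp; ring
    rw [this]; positivity
  have e7 : B ^ 2 / (8 * m) * (Q ^ 2 * l ^ 2) ≤ L ^ 2 / (8 * m) * (Q ^ 2 * l ^ 2) := by gcongr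
  linarith

theorem slice {N : ℕ} {a : Fin N → ℝ} (ha : ∀ i, 0 < a i) {L m M ρ ε C : ℝ} (hm : 0 < m)
    (hm1 : m ≤ 1) (hε : 0 < ε) (hρ : 0 < ρ)
    (hC : ∀ q P : ℝ, 1 ≤ P → P ≤ M →
      (ε ^ 2 + q ^ 2) ^ ((P - 2) / 2) * q ^ 2 * (Real.log (ε ^ 2 + q ^ 2)) ^ 2 ≤
        C * (1 + |q| ^ (P + ρ)))
    {P : Fin N → (Fin N → ℝ) → ℝ} (hPl : ∀ i, ∃ K : NNReal, LipschitzOnWith K (P i) (closure (Ka a)))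
    (hPx : ∀ i, ∀ x ∈ closure (Ka a), ∀ y ∈ closure (Ka a),
      |P i x - P i y| ≤ L * Real.sqrt (∑ j, (x j - y j) ^ 2))
    (hPm : ∀ i, ∀ x ∈ closure (Ka a), 1 + m ≤ P i x ∧ P i x ≤ M)
    {v g φ : (Fin N → ℝ) → ℝ} (hv : ContDiffOn ℝ (⊤ : ℕ∞) v (closure (Ka a)))
    (hg : ContDiffOn ℝ (⊤ : ℕ∞) g (closure (Ka a)))
    (hφ : ContDiffOn ℝ (⊤ : ℕ∞) φ (closure (Ka a)))
    (hv0 : ∀ x ∈ frontier (Ka a), v x = 0) (hg0 : ∀ x ∈ frontier (Ka a), g x = 0)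
    (hφ0 : ∀ x ∈ frontier (Ka a), φ x = 0)
    (hpde : ∀ x ∈ Ka a, g x = (∑ j, Dop j (fun y =>
              (ε ^ 2 + (Dop j v y) ^ 2) ^ ((P j y - 2) / 2) * Dop j v y) x) + φ x) :
    (m / 2) * (∑ i, ∑ j, ∫ x in Ka a, (ε ^ 2 + (Dop i v x) ^ 2) ^ ((P i x - 2) / 2) *
        (Dop i (Dop j v) x) ^ 2) + ∑ i, ∫ x in Ka a, Dop i g x * Dop i v x ≤
      N * (L ^ 2 / (8 * m) * C) * (∑ j, ∫ x in Ka a, (1 + |Dop j v x| ^ (P j x + ρ))) +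
        ∑ i, ∫ x in Ka a, Dop i φ x * Dop i v x := by
  set q : Fin N → (Fin N → ℝ) → ℝ := fun j => Dw a j v with hq
  set F : Fin N → (Fin N → ℝ) → ℝ := fun j y => (ε ^ 2 + q j y ^ 2) ^ ((P j y - 2) / 2) * q j y with hF
  have hqs : ∀ j, ContDiffOn ℝ (⊤ : ℕ∞) (q j) (closure (Ka a)) := fun j => Dw_smooth ha j hv
  have lipS : ∀ {h : (Fin N → ℝ) → ℝ}, ContDiffOn ℝ (⊤ : ℕ∞) h (closure (Ka a)) →
      ∃ K : NNReal, LipschitzOnWith K h (closure (Ka a)) := fun hh =>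
    lip_of_smooth (isCompact_cKa ha) (convex_Ka a).closure (uniqueDiff_cKa ha) hh
  have hFl : ∀ j, ∃ K : NNReal, LipschitzOnWith K (F j) (closure (Ka a)) := by
    intro j
    obtain ⟨K1, h1⟩ := lipS (hqs j)
    obtain ⟨K2, h2⟩ := hPl j
    exact F_lip ha hε h1 h2
  have hPc : ∀ j, ContinuousOn (P j) (closure (Ka a)) := fun j => (hPl j).choose_spec.continuousOn
  have hwc : ∀ j, ContinuousOn (fun x => (ε ^ 2 + q j x ^ 2) ^ ((P j x - 2) / 2)) (closure (Ka a)) := by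
    intro j
    refine ContinuousOn.rpow ?_ ?_ (fun x _ => Or.inl (by positivity))
    · exact continuousOn_const.add ((hqs j).continuousOn.pow 2)
    · exact ((hPc j).sub continuousOn_const).div_const 2
  have hac : ∀ j, ContinuousOn (fun x => 1 + |q j x| ^ (P j x + ρ)) (closure (Ka a)) := by
    intro j
    refine continuousOn_const.add (ContinuousOn.rpow (hqs j).continuousOn.abs
      ((hPc j).add continuousOn_const) (fun x hx => Or.inr ?_))
    have := (hPm j x hx).1
    linarith
  -- boundary values
  have hvf : ∀ i, ∀ x ∈ closure (Ka a), |x i| = a i → v x = 0 := fun i x hx h =>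
    hv0 x (mem_frontier_Ka hx h)
  have hqf : ∀ i j, i ≠ j → ∀ x ∈ closure (Ka a), |x j| = a j → q i x = 0 := fun i j hij =>
    Dw_face ha hij hv (hvf j)
  -- step 1
  have parts : ∀ {h : (Fin N → ℝ) → ℝ}, ContDiffOn ℝ (⊤ : ℕ∞) h (closure (Ka a)) →
      (∀ x ∈ frontier (Ka a), h x = 0) → ∀ i,
      ∫ x in Ka a, Dop i h x * Dop i v x = - ∫ x in Ka a, h x * Dw a i (q i) x := by
    intro h hh hh0 i
    obtain ⟨K, hK⟩ := lipS hh
    have := lem_B ha hK (hqs i) i (fun x hx hxi => by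
      rw [hh0 x (mem_frontier_Ka hx hxi), zero_mul])
    calc ∫ x in Ka a, Dop i h x * Dop i v x = ∫ x in Ka a, Dop i h x * q i x := by
          refine setIntegral_congr_fun (measurable_Ka a) fun x hx => ?_
          simp only [hq]; rw [Dw_eq_Dop i v hx]
      _ = _ := this
      _ = _ := by
          congr 1
          refine setIntegral_congr_fun (measurable_Ka a) fun x hx => ?_
          beta_reduce; rw [Dw_eq_Dop i _ hx]
  -- step 2
  have cross : ∀ i j, ∫ x in Ka a, Dop j (F j) x * Dw a i (q i) x =
      ∫ x in Ka a, Dop i (F j) x * Dw a j (q i) x := by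
    intro i j
    by_cases hij : i = j
    · subst hij; rfl
    obtain ⟨K, hK⟩ := hFl j
    rw [lem_B ha hK (Dw_smooth ha i (hqs i)) j, lem_B ha hK (Dw_smooth ha j (hqs i)) i]
    · congr 1
      refine setIntegral_congr_fun (measurable_Ka a) fun x hx => ?_
      have := Dw_symm i j (hqs i) hx
      beta_reduce
      rw [Dop_congr j (fun y hy => Dw_eq_Dop i (q i) hy) hx,
        Dop_congr i (fun y hy => Dw_eq_Dop j (q i) hy) hx, this]
    · intro x hx hxi
      simp only [hF]; rw [hqf j i (Ne.symm hij) x hx hxi]; simp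
    · intro x hx hxj
      rw [Dw_face ha hij (hqs i) (hqf i j hij) x hx hxj, mul_zero]
  -- step 3
  have hpde' : ∀ x ∈ Ka a, g x = (∑ j, Dop j (F j) x) + φ x := by
    intro x hx
    rw [hpde x hx]
    congr 1
    refine Finset.sum_congr rfl fun j _ => Dop_congr j (fun y hy => ?_) hx
    simp only [hF, hq]; rw [Dw_eq_Dop j v hy]
  have hqq : ∀ i j, ContinuousOn (Dw a j (q i)) (closure (Ka a)) := fun i j =>
    (Dw_smooth ha j (hqs i)).continuousOn
  have hIF : ∀ i j k l, IntegrableOn (fun x => Dop j (F k) x * Dw a l (q i) x) (Ka a) := by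
    intro i j k l
    obtain ⟨K, hK⟩ := hFl k
    exact int_Dop ha hK (hqq i l) j
  have step3 : ∀ i, ∫ x in Ka a, g x * Dw a i (q i) x =
      (∑ j, ∫ x in Ka a, Dop i (F j) x * Dw a j (q i) x) + ∫ x in Ka a, φ x * Dw a i (q i) x := by
    intro i
    have : ∫ x in Ka a, g x * Dw a i (q i) x =
        ∫ x in Ka a, ((∑ j, Dop j (F j) x * Dw a i (q i) x) + φ x * Dw a i (q i) x) := by
      refine setIntegral_congr_fun (measurable_Ka a) fun x hx => ?_
      beta_reduce
      rw [hpde' x hx, add_mul, Finset.sum_mul]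
    rw [this, integral_add, integral_finsetSum]
    · simp only [cross]
    · intro j _; exact hIF i j j i
    · exact integrable_finsetSum _ fun j _ => hIF i j j i
    · exact intOn_Ka ha (hφ.continuousOn.mul (hqq i i))
  -- step 4
  have step4 : ∀ i j, (m / 2) * (∫ x in Ka a, (ε ^ 2 + (Dop j v x) ^ 2) ^ ((P j x - 2) / 2) *
        (Dop j (Dop i v) x) ^ 2) -
        (L ^ 2 / (8 * m) * C) * (∫ x in Ka a, (1 + |Dop j v x| ^ (P j x + ρ))) ≤
      ∫ x in Ka a, Dop i (F j) x * Dw a j (q i) x := by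
    intro i j
    have e1 : ∫ x in Ka a, (ε ^ 2 + (Dop j v x) ^ 2) ^ ((P j x - 2) / 2) *
        (Dop j (Dop i v) x) ^ 2 = ∫ x in Ka a, (ε ^ 2 + q j x ^ 2) ^ ((P j x - 2) / 2) *
        (Dw a j (q i) x) ^ 2 := by
      refine setIntegral_congr_fun (measurable_Ka a) fun x hx => ?_
      simp only [hq]
      rw [Dw_eq_Dop j v hx, Dw_eq_Dop j _ hx, Dop_congr j (fun y hy => Dw_eq_Dop i v hy) hx]
    have e2 : ∫ x in Ka a, (1 + |Dop j v x| ^ (P j x + ρ)) =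
        ∫ x in Ka a, (1 + |q j x| ^ (P j x + ρ)) := by
      refine setIntegral_congr_fun (measurable_Ka a) fun x hx => ?_
      simp only [hq]
      rw [Dw_eq_Dop j v hx]
    have i1 : IntegrableOn (fun x => (ε ^ 2 + q j x ^ 2) ^ ((P j x - 2) / 2) *
        (Dw a j (q i) x) ^ 2) (Ka a) := intOn_Ka ha ((hwc j).mul ((hqq i j).pow 2))
    have i2 := intOn_Ka ha (hac j)
    rw [e1, e2, ← integral_const_mul, ← integral_const_mul, ← integral_sub (i1.const_mul _) (i2.const_mul _)]
    refine integral_mono_ae ((i1.const_mul _).sub (i2.const_mul _)) (hIF i i j j) ?_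
    obtain ⟨K, hK⟩ := hPl j
    refine (ae_restrict_iff' (measurable_Ka a)).2 ?_
    filter_upwards [ae_diff hK] with x hPd hx
    have hxc := subset_closure hx
    have hqd : DifferentiableAt ℝ (q j) x :=
      ((hqs j).contDiffAt (cKa_mem_nhds hx)).differentiableAt (by simp)
    have key := pointwise hε hm hm1 hqd (hPd hx) i (DP_le (hPx j) hx (hPd hx) i) (hPm j x hxc).1
    have hsym : Dop i (q j) x = Dw a j (q i) x := by
      rw [Dw_eq_Dop j _ hx, Dop_congr j (fun y hy => Dw_eq_Dop i v hy) hx,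
        Dop_congr i (fun y hy => Dw_eq_Dop j v hy) hx, Dw_symm i j hv hx]
    rw [hsym] at key
    have hb := hC (q j x) (P j x) (by have := (hPm j x hxc).1; linarith) (hPm j x hxc).2
    have hb' := mul_le_mul_of_nonneg_left hb (by positivity : 0 ≤ L ^ 2 / (8 * m))
    refine le_trans ?_ key
    beta_reduce
    linarith
  -- conclusion
  have eqg : ∀ i, ∫ x in Ka a, Dop i g x * Dop i v x =
      - (∑ j, ∫ x in Ka a, Dop i (F j) x * Dw a j (q i) x) + ∫ x in Ka a, Dop i φ x * Dop i v x := by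
    intro i
    rw [parts hg hg0 i, parts hφ hφ0 i, step3 i]; ring
  have hsum := Finset.sum_le_sum fun i (_ : i ∈ Finset.univ) =>
    Finset.sum_le_sum fun j (_ : j ∈ Finset.univ) => step4 i j
  simp only [Finset.sum_sub_distrib, ← Finset.mul_sum, Finset.sum_const, Finset.card_univ,
    Fintype.card_fin, nsmul_eq_mul] at hsum
  rw [Finset.sum_comm] at hsum
  simp only [eqg, Finset.sum_add_distrib, Finset.sum_neg_distrib]
  linarith


section cyl
variable {N : ℕ} {a : Fin N → ℝ} {T : ℝ}

/-- closed cylinder -/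
def cyl {N : ℕ} (a : Fin N → ℝ) (T : ℝ) : Set ((Fin N → ℝ) × ℝ) := closure (Ka a) ×ˢ Set.Icc 0 T

/-- within derivative on the cylinder -/
def DZ {N : ℕ} (a : Fin N → ℝ) (T : ℝ) (d : (Fin N → ℝ) × ℝ) (U : (Fin N → ℝ) × ℝ → ℝ) :
    (Fin N → ℝ) × ℝ → ℝ := fun z => fderivWithin ℝ U (cyl a T) z d

/-- spatial direction -/
def eX {N : ℕ} (i : Fin N) : (Fin N → ℝ) × ℝ := (Pi.single i 1, 0)

theorem isCompact_cyl (ha : ∀ i, 0 < a i) : IsCompact (cyl a T) :=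
  (isCompact_cKa ha).prod isCompact_Icc

theorem convex_cyl : Convex ℝ (cyl a T) := (convex_Ka a).closure.prod (convex_Icc 0 T)

theorem cyl_nhds {x : Fin N → ℝ} {s : ℝ} (hx : x ∈ Ka a) (hs : s ∈ Set.Ioo 0 T) :
    cyl a T ∈ nhds (x, s) := prod_mem_nhds (cKa_mem_nhds hx) (Icc_mem_nhds hs.1 hs.2)

theorem uniqueDiff_cyl (ha : ∀ i, 0 < a i) (hT : 0 < T) : UniqueDiffOn ℝ (cyl a T) :=
  uniqueDiffOn_convex convex_cyl ⟨(0, T / 2), mem_interior_iff_mem_nhds.2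
    (cyl_nhds (zero_mem_Ka ha) ⟨by linarith, by linarith⟩)⟩

theorem DZ_smooth (ha : ∀ i, 0 < a i) (hT : 0 < T) (d : (Fin N → ℝ) × ℝ)
    {U : (Fin N → ℝ) × ℝ → ℝ} (hU : ContDiffOn ℝ (⊤ : ℕ∞) U (cyl a T)) :
    ContDiffOn ℝ (⊤ : ℕ∞) (DZ a T d U) (cyl a T) :=
  (hU.fderivWithin (uniqueDiff_cyl ha hT) (by simp)).clm_apply contDiffOn_const

theorem slice_smooth {U : (Fin N → ℝ) × ℝ → ℝ} (hU : ContDiffOn ℝ (⊤ : ℕ∞) U (cyl a T)) {s : ℝ}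
    (hs : s ∈ Set.Icc 0 T) : ContDiffOn ℝ (⊤ : ℕ∞) (fun y => U (y, s)) (closure (Ka a)) :=
  hU.comp (contDiff_id.prodMk contDiff_const).contDiffOn (fun _ hy => ⟨hy, hs⟩)

theorem slice_deriv {U : (Fin N → ℝ) × ℝ → ℝ}
    (hU : ContDiffOn ℝ (⊤ : ℕ∞) U (cyl a T)) {s : ℝ} (hs : s ∈ Set.Icc 0 T) (i : Fin N)
    {x : Fin N → ℝ} (hx : x ∈ Ka a) : Dop i (fun y => U (y, s)) x = DZ a T (eX i) U (x, s) := by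
  have h1 : HasFDerivWithinAt U (fderivWithin ℝ U (cyl a T) (x, s)) (cyl a T) (x, s) :=
    (hU.differentiableOn (by simp) (x, s) ⟨subset_closure hx, hs⟩).hasFDerivWithinAt
  have h2 : HasFDerivWithinAt (fun y : Fin N → ℝ => (y, s)) (ContinuousLinearMap.inl ℝ (Fin N → ℝ) ℝ)
      (closure (Ka a)) x := (hasFDerivAt_prodMk_left x s).hasFDerivWithinAt
  have hmaps : Set.MapsTo (fun y : Fin N → ℝ => (y, s)) (closure (Ka a)) (cyl a T) :=
    fun y hy => ⟨hy, hs⟩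
  have h3 := h1.comp x h2 hmaps
  have h4 := (h3.hasFDerivAt (cKa_mem_nhds hx)).fderiv
  have h5 : (U ∘ fun y : Fin N → ℝ => (y, s)) = fun y => U (y, s) := rfl
  rw [h5] at h4
  simp only [Dop, DZ, eX]
  rw [h4]
  simp

theorem slice_deriv2 (ha : ∀ i, 0 < a i) (hT : 0 < T) {U : (Fin N → ℝ) × ℝ → ℝ}
    (hU : ContDiffOn ℝ (⊤ : ℕ∞) U (cyl a T)) {s : ℝ} (hs : s ∈ Set.Icc 0 T) (i j : Fin N)
    {x : Fin N → ℝ} (hx : x ∈ Ka a) : Dop i (Dop j (fun y => U (y, s))) x =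
      DZ a T (eX i) (DZ a T (eX j) U) (x, s) := by
  rw [← slice_deriv (DZ_smooth ha hT _ hU) hs i hx]
  exact Dop_congr i (fun y hy => slice_deriv hU hs j hy) hx

theorem time_deriv {U : (Fin N → ℝ) × ℝ → ℝ}
    (hU : ContDiffOn ℝ (⊤ : ℕ∞) U (cyl a T)) {s : ℝ} (hs : s ∈ Set.Ioo 0 T)
    {x : Fin N → ℝ} (hx : x ∈ closure (Ka a)) :
    HasDerivAt (fun τ => U (x, τ)) (DZ a T (0, 1) U (x, s)) s := by
  have h1 : HasFDerivWithinAt U (fderivWithin ℝ U (cyl a T) (x, s)) (cyl a T) (x, s) :=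
    (hU.differentiableOn (by simp) (x, s) ⟨hx, Set.Ioo_subset_Icc_self hs⟩).hasFDerivWithinAt
  have h2 : HasDerivWithinAt (fun τ : ℝ => (x, τ)) ((0 : Fin N → ℝ), (1:ℝ)) (Set.Icc 0 T) s :=
    ((hasDerivAt_const s x).prodMk (hasDerivAt_id s)).hasDerivWithinAt
  have h3 := h1.comp_hasDerivWithinAt s h2 (fun y hy => ⟨hx, hy⟩)
  exact h3.hasDerivAt (Icc_mem_nhds hs.1 hs.2)

theorem time_zero {U : (Fin N → ℝ) × ℝ → ℝ}
    (hU : ContDiffOn ℝ (⊤ : ℕ∞) U (cyl a T)) {s : ℝ} (hs : s ∈ Set.Ioo 0 T)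
    {x : Fin N → ℝ} (hx : x ∈ closure (Ka a)) (h0 : ∀ t ∈ Set.Icc 0 T, U (x, t) = 0) :
    DZ a T (0, 1) U (x, s) = 0 := by
  refine (time_deriv hU hs hx).unique ?_
  refine (hasDerivAt_const s (0:ℝ)).congr_of_eventuallyEq ?_
  filter_upwards [Icc_mem_nhds hs.1 hs.2] with t ht using h0 t ht

theorem DZ_symm (d e : (Fin N → ℝ) × ℝ) {U : (Fin N → ℝ) × ℝ → ℝ}
    (hU : ContDiffOn ℝ (⊤ : ℕ∞) U (cyl a T)) {s : ℝ} (hs : s ∈ Set.Ioo 0 T)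
    {x : Fin N → ℝ} (hx : x ∈ Ka a) :
    DZ a T d (DZ a T e U) (x, s) = DZ a T e (DZ a T d U) (x, s) := by
  have hn := cyl_nhds hx hs
  have h1 : ContDiffAt ℝ (⊤ : ℕ∞) U (x, s) := hU.contDiffAt hn
  have h2 : DifferentiableAt ℝ (fderiv ℝ U) (x, s) :=
    (h1.fderiv_right (m := (⊤ : ℕ∞)) (by simp)).differentiableAt (by simp)
  have h3 := h1.isSymmSndFDerivAt (by
    rw [minSmoothness_of_isRCLikeNormedField]
    exact WithTop.coe_le_coe.2 (le_top : (2 : ℕ∞) ≤ ⊤))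
  have key : ∀ d e, DZ a T d (DZ a T e U) (x, s) = fderiv ℝ (fderiv ℝ U) (x, s) d e := by
    intro d e
    have hEq : DZ a T e U =ᶠ[nhds (x, s)] fun z => fderiv ℝ U z e := by
      have : (Ka a ×ˢ Set.Ioo 0 T) ∈ nhds (x, s) :=
        prod_mem_nhds ((isOpen_Ka a).mem_nhds hx) (Ioo_mem_nhds hs.1 hs.2)
      filter_upwards [this] with z hz
      simp only [DZ]
      rw [fderivWithin_of_mem_nhds (cyl_nhds hz.1 hz.2)]
    unfold DZ at hEq ⊢
    rw [fderivWithin_of_mem_nhds hn, hEq.fderiv_eq, fderiv_clm_apply h2 (differentiableAt_const _)]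
    simp
  rw [key, key]; exact h3 _ _

theorem int_cyl (ha : ∀ i, 0 < a i) {g : (Fin N → ℝ) × ℝ → ℝ} (hg : ContinuousOn g (cyl a T))
    {t : ℝ} (ht : t ≤ T) :
    Integrable g ((volume.restrict (Ka a)).prod (volume.restrict (Set.Ioo 0 t))) := by
  rw [Measure.prod_restrict]
  have : IntegrableOn g (cyl a T) ((volume : Measure (Fin N → ℝ)).prod (volume : Measure ℝ)) :=
    hg.integrableOn_compact (isCompact_cyl ha)
  exact this.mono_set (Set.prod_mono subset_closure
    (fun s hs => ⟨hs.1.le, hs.2.le.trans ht⟩))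

theorem int_slice (ha : ∀ i, 0 < a i) {g : (Fin N → ℝ) × ℝ → ℝ} (hg : ContinuousOn g (cyl a T))
    {g' : (Fin N → ℝ) → ℝ → ℝ} (h : ∀ s ∈ Set.Ioo 0 T, ∀ x ∈ Ka a, g' x s = g (x, s)) :
    IntegrableOn (fun s => ∫ x in Ka a, g' x s) (Set.Ioo 0 T) := by
  have h1 := (int_cyl ha hg le_rfl).integral_prod_right
  refine IntegrableOn.congr_fun (show IntegrableOn _ _ _ from h1) (fun s hs => ?_) measurableSet_Ioo
  exact (setIntegral_congr_fun (measurable_Ka a) (fun x hx => h s hs x hx)).symm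

theorem ftc_slice (ha : ∀ i, 0 < a i) (hT : 0 < T) {q : (Fin N → ℝ) × ℝ → ℝ}
    (hq : ContDiffOn ℝ (⊤ : ℕ∞) q (cyl a T)) {t : ℝ} (ht : t ∈ Set.Icc 0 T) :
    ∫ s in Set.Ioo 0 t, ∫ x in Ka a, DZ a T (0, 1) q (x, s) * q (x, s) =
      1 / 2 * ((∫ x in Ka a, q (x, t) ^ 2) - ∫ x in Ka a, q (x, 0) ^ 2) := by
  have hd := (DZ_smooth ha hT (0, 1) hq).continuousOn
  have hI := int_cyl ha (hd.mul hq.continuousOn) ht.2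
  rw [integral_integral_swap (f := fun s x => DZ a T (0, 1) q (x, s) * q (x, s)) hI.swap]
  have hc : ∀ r ∈ Set.Icc 0 T, ContinuousOn (fun x => q (x, r) ^ 2) (closure (Ka a)) := fun r hr =>
    (slice_smooth hq hr).continuousOn.pow 2
  have h0 : (0:ℝ) ∈ Set.Icc 0 T := ⟨le_rfl, hT.le⟩
  rw [← integral_sub (intOn_Ka ha (hc t ht)) (intOn_Ka ha (hc 0 h0)), ← integral_const_mul]
  refine setIntegral_congr_fun (measurable_Ka a) (fun x hx => ?_)
  have hxc := subset_closure hx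
  have hmaps : Set.MapsTo (fun s : ℝ => (x, s)) (Set.Icc 0 t) (cyl a T) := fun s hs =>
    ⟨hxc, hs.1, hs.2.trans ht.2⟩
  have hline : ContinuousOn (fun s : ℝ => (x, s)) (Set.Icc 0 t) := by fun_prop
  have hqc := hq.continuousOn.comp hline hmaps
  have hdc := hd.comp hline hmaps
  have key := intervalIntegral.integral_eq_sub_of_hasDerivAt_of_le ht.1
    (f := fun s => 1 / 2 * q (x, s) ^ 2) (f' := fun s => DZ a T (0, 1) q (x, s) * q (x, s))
    (continuousOn_const.mul (hqc.pow 2)) (fun s hs => by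
      have h1 := ((time_deriv hq ⟨hs.1, hs.2.trans_le ht.2⟩ hxc).pow 2).const_mul (1/2 : ℝ)
      refine h1.congr_deriv ?_
      simp; ring)
    (by
      apply ContinuousOn.intervalIntegrable
      rw [Set.uIcc_of_le ht.1]
      exact hdc.mul hqc)
  rw [intervalIntegral.integral_of_le ht.1, integral_Ioc_eq_integral_Ioo] at key
  refine key.trans ?_
  ring

end cyl

theorem abs_energy {T m c1 Eb : ℝ} (hT : 0 < T) (hm : 0 < m) (hc1 : 0 ≤ c1)
    {E W B R Q Φ : ℝ → ℝ}
    (iE : IntegrableOn E (Set.Ioo 0 T)) (iW : IntegrableOn W (Set.Ioo 0 T))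
    (iB : IntegrableOn B (Set.Ioo 0 T)) (iR : IntegrableOn R (Set.Ioo 0 T))
    (iΦ : IntegrableOn Φ (Set.Ioo 0 T))
    (hW : ∀ s, 0 ≤ W s) (hR : ∀ s, 0 ≤ R s) (hΦ : ∀ s, 0 ≤ Φ s) (hE : ∀ s, 0 ≤ E s)
    (hs : ∀ s ∈ Set.Ioo 0 T, m / 2 * W s + B s ≤ c1 * R s + Q s)
    (hQ : ∀ s ∈ Set.Ioo 0 T, Q s ≤ T * Φ s + 1 / (4 * T) * E s)
    (hB : ∀ t ∈ Set.Icc 0 T, ∫ s in Set.Ioo 0 t, B s = 1 / 2 * (E t - E 0))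
    (hEb : ∀ t ∈ Set.Icc 0 T, E t ≤ Eb) :
    ∀ t ∈ Set.Icc 0 T, E t + ∫ s in Set.Ioo 0 T, W s ≤
      (4 + 4 / m) * (1 / 2 * E 0 + c1 * (∫ s in Set.Ioo 0 T, R s) + T * ∫ s in Set.Ioo 0 T, Φ s) := by
  set A := 1 / 2 * E 0 + c1 * (∫ s in Set.Ioo 0 T, R s) + T * ∫ s in Set.Ioo 0 T, Φ s with hA
  set M := sSup (E '' Set.Icc 0 T) with hM
  have hbdd : BddAbove (E '' Set.Icc 0 T) := ⟨Eb, by rintro _ ⟨t, ht, rfl⟩; exact hEb t ht⟩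
  have hne : (E '' Set.Icc 0 T).Nonempty := ⟨E 0, 0, ⟨le_rfl, hT.le⟩, rfl⟩
  have hEM : ∀ t ∈ Set.Icc 0 T, E t ≤ M := fun t ht => le_csSup hbdd ⟨t, ht, rfl⟩
  have key : ∀ t ∈ Set.Icc 0 T, m / 2 * (∫ s in Set.Ioo 0 t, W s) + 1 / 2 * E t ≤ A + M / 4 := by
    intro t ht
    have hsub : Set.Ioo 0 t ⊆ Set.Ioo 0 T := Set.Ioo_subset_Ioo le_rfl ht.2
    have jE := iE.mono_set hsub
    have jW := iW.mono_set hsub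
    have jB := iB.mono_set hsub
    have jR := iR.mono_set hsub
    have jΦ := iΦ.mono_set hsub
    have h1 : ∫ s in Set.Ioo 0 t, (m / 2 * W s + B s) ≤
        ∫ s in Set.Ioo 0 t, ((c1 * R s + T * Φ s) + 1 / (4 * T) * E s) := by
      refine setIntegral_mono_on ((jW.const_mul _).add jB)
        (((jR.const_mul _).add (jΦ.const_mul _)).add (jE.const_mul _)) measurableSet_Ioo ?_
      intro s hs'
      linarith [hs s (hsub hs'), hQ s (hsub hs')]
    have hj : IntegrableOn (fun s => c1 * R s + T * Φ s) (Set.Ioo 0 t) :=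
      (jR.const_mul _).add (jΦ.const_mul _)
    rw [integral_add (jW.const_mul _) jB,
      integral_add hj (jE.const_mul _),
      integral_add (jR.const_mul _) (jΦ.const_mul _), integral_const_mul, integral_const_mul,
      integral_const_mul, integral_const_mul, hB t ht] at h1
    have h2 : ∫ s in Set.Ioo 0 t, R s ≤ ∫ s in Set.Ioo 0 T, R s :=
      setIntegral_mono_set iR (Filter.Eventually.of_forall hR) hsub.eventuallyLE
    have h3 : ∫ s in Set.Ioo 0 t, Φ s ≤ ∫ s in Set.Ioo 0 T, Φ s :=
      setIntegral_mono_set iΦ (Filter.Eventually.of_forall hΦ) hsub.eventuallyLE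
    have h4 : ∫ s in Set.Ioo 0 t, E s ≤ T * M := by
      have h5 : ∫ s in Set.Ioo 0 t, E s ≤ ∫ s in Set.Ioo 0 T, E s :=
        setIntegral_mono_set iE (Filter.Eventually.of_forall hE) hsub.eventuallyLE
      have h6 : ∫ s in Set.Ioo 0 T, E s ≤ ∫ s in Set.Ioo 0 T, M :=
        setIntegral_mono_on iE (integrableOn_const (by simp)) measurableSet_Ioo
          (fun s hs' => hEM s (Set.Ioo_subset_Icc_self hs'))
      refine (h5.trans h6).trans (le_of_eq ?_)
      simp [hT.le]
    have h7 : 1 / (4 * T) * ∫ s in Set.Ioo 0 t, E s ≤ M / 4 := by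
      calc _ ≤ 1 / (4 * T) * (T * M) := by gcongr
        _ = M / 4 := by field_simp
    have h8 := mul_le_mul_of_nonneg_left h2 hc1
    have h9 := mul_le_mul_of_nonneg_left h3 hT.le
    linarith
  have hWn : ∀ t, 0 ≤ ∫ s in Set.Ioo 0 t, W s := fun t => integral_nonneg hW
  have hMA : M ≤ 4 * A := by
    have : M ≤ 2 * A + M / 2 := by
      refine csSup_le hne ?_
      rintro _ ⟨t, ht, rfl⟩
      have h1 := key t ht
      have h2 : 0 ≤ m / 2 * ∫ s in Set.Ioo 0 t, W s := mul_nonneg (by linarith) (hWn t)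
      linarith
    linarith
  intro t ht
  have h1 := key T ⟨hT.le, le_rfl⟩
  have h2 := hE T
  have h3 : m / 2 * (∫ s in Set.Ioo 0 T, W s) ≤ 2 * A := by linarith
  have h4 : ∫ s in Set.Ioo 0 T, W s ≤ 4 / m * A := by
    rw [div_mul_eq_mul_div, le_div_iff₀ hm]; linarith
  linarith [hEM t ht]


theorem p_bounds {N : ℕ} (hN : 2 ≤ N) {a : Fin N → ℝ} (ha : ∀ i, 0 < a i) {T : ℝ} (hT : 0 < T)
    {p : Fin N → ((Fin N → ℝ) × ℝ) → ℝ} (hc : ∀ i, ContinuousOn (p i) (cyl a T))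
    (hp : ∀ i, ∀ z ∈ cyl a T, 2 * N / (N + 2) < p i z) :
    ∃ m M : ℝ, 0 < m ∧ m ≤ 1 ∧ ∀ i, ∀ z ∈ cyl a T, 1 + m ≤ p i z ∧ p i z ≤ M := by
  have hne : (cyl a T).Nonempty := ⟨(0, 0), subset_closure (zero_mem_Ka ha), le_rfl, hT.le⟩
  have h1 : (1:ℝ) ≤ 2 * N / (N + 2) := by
    have : (2:ℝ) ≤ N := by exact_mod_cast hN
    rw [le_div_iff₀ (by linarith)]; linarith
  have hmin : ∀ i, ∃ z ∈ cyl a T, ∀ y ∈ cyl a T, p i z ≤ p i y := fun i =>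
    (isCompact_cyl ha).exists_isMinOn hne (hc i)
  have hmax : ∀ i, ∃ z ∈ cyl a T, ∀ y ∈ cyl a T, p i y ≤ p i z := fun i =>
    (isCompact_cyl ha).exists_isMaxOn hne (hc i)
  choose zm hzm hzm' using hmin
  choose zM hzM hzM' using hmax
  have hNe : (Finset.univ : Finset (Fin N)).Nonempty := ⟨⟨0, by omega⟩, Finset.mem_univ _⟩
  refine ⟨min 1 (Finset.univ.inf' hNe fun i => p i (zm i) - 1),
    Finset.univ.sup' hNe fun i => p i (zM i), ?_, min_le_left _ _, ?_⟩
  · rw [lt_min_iff]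
    refine ⟨one_pos, ?_⟩
    rw [Finset.lt_inf'_iff]
    intro i _
    linarith [hp i _ (hzm i)]
  · intro i z hz
    constructor
    · have := (min_le_right 1 (Finset.univ.inf' hNe fun i => p i (zm i) - 1)).trans
        (Finset.inf'_le (fun i => p i (zm i) - 1) (Finset.mem_univ i))
      linarith [hzm' i z hz]
    · exact (hzM' i z hz).trans (Finset.le_sup' (fun i => p i (zM i)) (Finset.mem_univ i))

theorem stmt19 (N : ℕ) (hN : 2 ≤ N) (a : Fin N → ℝ) (ha : ∀ i, 0 < a i)
    (T : ℝ) (hT : 0 < T) (L : ℝ) (hL : 0 ≤ L)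
    (p : Fin N → ((Fin N → ℝ) × ℝ) → ℝ)
    (hpLip : ∀ i, ∃ K : NNReal, LipschitzOnWith K (p i) (closure (Ka a) ×ˢ Set.Icc 0 T))
    (hp : ∀ i, ∀ z ∈ closure (Ka a) ×ˢ Set.Icc 0 T, 2 * N / (N + 2) < p i z)
    -- `|∇_x p_i| ≤ L` a.e. in `Q_T`, expressed as Lipschitz continuity in space
    (hpx : ∀ i, ∀ t ∈ Set.Icc 0 T, ∀ x ∈ closure (Ka a), ∀ y ∈ closure (Ka a),
      |p i (x, t) - p i (y, t)| ≤ L * Real.sqrt (∑ j, (x j - y j) ^ 2)) :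
    ∀ ρ ∈ Set.Ioo (0 : ℝ) 1,
    ∃ C : ℝ, 0 < C ∧
      ∀ ε ∈ Set.Ioo (0 : ℝ) 1,
      ∀ f : (Fin N → ℝ) → ℝ → ℝ,
        ContDiffOn ℝ (⊤ : ℕ∞) (fun z : (Fin N → ℝ) × ℝ => f z.1 z.2)
          (closure (Ka a) ×ˢ Set.Icc 0 T) →
        (∀ t ∈ Set.Icc 0 T, ∀ x ∈ frontier (Ka a), f x t = 0) →
      ∀ u : (Fin N → ℝ) → ℝ → ℝ,
        ContDiffOn ℝ (⊤ : ℕ∞) (fun z : (Fin N → ℝ) × ℝ => u z.1 z.2)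
          (closure (Ka a) ×ˢ Set.Icc 0 T) →
        (∀ x ∈ frontier (Ka a), ∀ t ∈ Set.Icc 0 T, u x t = 0) →
        (∀ x ∈ Ka a, ∀ t ∈ Set.Ioo 0 T,
          deriv (fun τ => u x τ) t =
            (∑ j, Dop j (fun y =>
              (ε ^ 2 + (Dop j (fun y' => u y' t) y) ^ 2) ^ ((p j (y, t) - 2) / 2) *
                Dop j (fun y' => u y' t) y) x) + f x t) →
      ∀ t ∈ Set.Ioo 0 T,
        (∫ x in Ka a, ∑ i, (Dop i (fun y => u y t) x) ^ 2) +
          (∑ i, ∑ j, ∫ s in Set.Ioo 0 T, ∫ x in Ka a,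
            (ε ^ 2 + (Dop i (fun y => u y s) x) ^ 2) ^ ((p i (x, s) - 2) / 2) *
              (Dop i (Dop j (fun y => u y s)) x) ^ 2) ≤
        C * (1 + (∑ i, ∫ s in Set.Ioo 0 T, ∫ x in Ka a,
              |Dop i (fun y => u y s) x| ^ (p i (x, s) + ρ)) +
            (∫ x in Ka a, ∑ i, (Dop i (fun y => u y 0) x) ^ 2) +
            ∫ s in Set.Ioo 0 T, ∫ x in Ka a, ∑ i, (Dop i (fun y => f y s) x) ^ 2) := by
  intro ρ hρ
  have hpc : ∀ i, ContinuousOn (p i) (cyl a T) := fun i => (hpLip i).choose_spec.continuousOn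
  obtain ⟨m, M, hm, hm1, hmM⟩ := p_bounds hN ha hT hpc hp
  obtain ⟨C0, hC0, hlog⟩ := log_bound ρ hρ.1 hρ.2 M
  set c1 : ℝ := N * (L ^ 2 / (8 * m) * C0) with hc1
  have hc1' : 0 ≤ c1 := by positivity
  set V : ℝ := (volume (Ka a)).toReal with hV
  have hV0 : 0 ≤ V := ENNReal.toReal_nonneg
  set C2 : ℝ := 1 / 2 + c1 * (N * (T * V) + 1) + T with hC2
  have hC2' : 0 < C2 := by positivity
  refine ⟨(4 + 4 / m) * C2, by positivity, ?_⟩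
  intro ε hε f hf hf0 u hu hu0 hpde
  set U : (Fin N → ℝ) × ℝ → ℝ := fun z => u z.1 z.2 with hU
  set Ff : (Fin N → ℝ) × ℝ → ℝ := fun z => f z.1 z.2 with hFf
  change ContDiffOn ℝ (⊤ : ℕ∞) U (cyl a T) at hu
  change ContDiffOn ℝ (⊤ : ℕ∞) Ff (cyl a T) at hf
  have hIcc : ∀ {s}, s ∈ Set.Ioo 0 T → s ∈ Set.Icc 0 T := fun h => Set.Ioo_subset_Icc_self h
  have h0T : (0:ℝ) ∈ Set.Icc 0 T := ⟨le_rfl, hT.le⟩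
  -- continuity on the cylinder
  have cU : ∀ i, ContinuousOn (DZ a T (eX i) U) (cyl a T) := fun i => (DZ_smooth ha hT _ hu).continuousOn
  have cf : ∀ i, ContinuousOn (DZ a T (eX i) Ff) (cyl a T) := fun i => (DZ_smooth ha hT _ hf).continuousOn
  have cUU : ∀ i j, ContinuousOn (DZ a T (eX i) (DZ a T (eX j) U)) (cyl a T) := fun i j =>
    (DZ_smooth ha hT _ (DZ_smooth ha hT _ hu)).continuousOn
  have hut := DZ_smooth ha hT (0, 1) hu
  have cUt : ∀ i, ContinuousOn (DZ a T (eX i) (DZ a T (0, 1) U)) (cyl a T) := fun i =>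
    (DZ_smooth ha hT _ hut).continuousOn
  have cw : ∀ i, ContinuousOn (fun z => (ε ^ 2 + (DZ a T (eX i) U z) ^ 2) ^ ((p i z - 2) / 2))
      (cyl a T) := by
    intro i
    have hε0 := hε.1
    refine ContinuousOn.rpow (continuousOn_const.add ((cU i).pow 2))
      (((hpc i).sub continuousOn_const).div_const 2) (fun z _ => Or.inl (by positivity))
  have cR : ∀ i, ContinuousOn (fun z => |DZ a T (eX i) U z| ^ (p i z + ρ)) (cyl a T) := by
    intro i
    refine ContinuousOn.rpow (cU i).abs ((hpc i).add continuousOn_const) (fun z hz => Or.inr ?_)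
    have := (hmM i z hz).1
    have := hρ.1
    linarith
  -- derivative identifications
  have dU : ∀ i, ∀ s ∈ Set.Icc 0 T, ∀ x ∈ Ka a, Dop i (fun y => u y s) x = DZ a T (eX i) U (x, s) :=
    fun i s hs x hx => slice_deriv hu hs i hx
  have df : ∀ i, ∀ s ∈ Set.Icc 0 T, ∀ x ∈ Ka a, Dop i (fun y => f y s) x = DZ a T (eX i) Ff (x, s) :=
    fun i s hs x hx => slice_deriv hf hs i hx
  have dUU : ∀ i j, ∀ s ∈ Set.Icc 0 T, ∀ x ∈ Ka a, Dop i (Dop j (fun y => u y s)) x =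
      DZ a T (eX i) (DZ a T (eX j) U) (x, s) :=
    fun i j s hs x hx => slice_deriv2 ha hT hu hs i j hx
  have dUt : ∀ i, ∀ s ∈ Set.Icc 0 T, ∀ x ∈ Ka a, Dop i (fun y => DZ a T (0, 1) U (y, s)) x =
      DZ a T (eX i) (DZ a T (0, 1) U) (x, s) :=
    fun i s hs x hx => slice_deriv hut hs i hx
  -- integrability
  have iW : ∀ i j, IntegrableOn (fun s => ∫ x in Ka a,
      (ε ^ 2 + (Dop i (fun y => u y s) x) ^ 2) ^ ((p i (x, s) - 2) / 2) *
              (Dop i (Dop j (fun y => u y s)) x) ^ 2) (Set.Ioo 0 T) := fun i j =>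
    int_slice ha ((cw i).mul ((cUU i j).pow 2)) (fun s hs x hx => by
      rw [dU i s (hIcc hs) x hx, dUU i j s (hIcc hs) x hx]; rfl)
  have iR : ∀ i, IntegrableOn (fun s => ∫ x in Ka a,
      |Dop i (fun y => u y s) x| ^ (p i (x, s) + ρ)) (Set.Ioo 0 T) := fun i =>
    int_slice ha (cR i) (fun s hs x hx => by rw [dU i s (hIcc hs) x hx])
  have iR1 : ∀ i, IntegrableOn (fun s => ∫ x in Ka a,
      (1 + |Dop i (fun y => u y s) x| ^ (p i (x, s) + ρ))) (Set.Ioo 0 T) := fun i =>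
    int_slice ha (g := fun z => 1 + |DZ a T (eX i) U z| ^ (p i z + ρ)) (continuousOn_const.add (cR i)) (fun s hs x hx => by rw [dU i s (hIcc hs) x hx])
  have iB : ∀ i, IntegrableOn (fun s => ∫ x in Ka a,
      Dop i (fun y => DZ a T (0, 1) U (y, s)) x * Dop i (fun y => u y s) x) (Set.Ioo 0 T) := fun i =>
    int_slice ha ((cUt i).mul (cU i)) (fun s hs x hx => by
      rw [dU i s (hIcc hs) x hx, dUt i s (hIcc hs) x hx]; rfl)
  have cE : ContinuousOn (fun z => ∑ i, (DZ a T (eX i) U z) ^ 2) (cyl a T) :=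
    continuousOn_finsetSum _ fun i _ => (cU i).pow 2
  have cΦ : ContinuousOn (fun z => ∑ i, (DZ a T (eX i) Ff z) ^ 2) (cyl a T) :=
    continuousOn_finsetSum _ fun i _ => (cf i).pow 2
  have iE : IntegrableOn (fun s => ∫ x in Ka a, ∑ i, (Dop i (fun y => u y s) x) ^ 2) (Set.Ioo 0 T) :=
    int_slice ha cE (fun s hs x hx => by
      exact Finset.sum_congr rfl fun i _ => by rw [dU i s (hIcc hs) x hx])
  have iΦ : IntegrableOn (fun s => ∫ x in Ka a, ∑ i, (Dop i (fun y => f y s) x) ^ 2) (Set.Ioo 0 T) :=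
    int_slice ha cΦ (fun s hs x hx => by
      exact Finset.sum_congr rfl fun i _ => by rw [df i s (hIcc hs) x hx])
  -- slices of continuous functions
  have hsl : ∀ {g : (Fin N → ℝ) × ℝ → ℝ}, ContinuousOn g (cyl a T) → ∀ s ∈ Set.Icc 0 T,
      IntegrableOn (fun x => g (x, s)) (Ka a) := fun hg s hs =>
    intOn_Ka ha (hg.comp (by fun_prop : ContinuousOn (fun x : Fin N → ℝ => (x, s)) (closure (Ka a)))
      (fun x hx => ⟨hx, hs⟩))
  have jE : ∀ i, ∀ s ∈ Set.Icc 0 T, IntegrableOn (fun x => (Dop i (fun y => u y s) x) ^ 2) (Ka a) :=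
    fun i s hs => (hsl ((cU i).pow 2) s hs).congr_fun
      (fun x hx => by simp only [Pi.pow_apply]; rw [dU i s hs x hx]) (measurable_Ka a)
  have jΦ : ∀ i, ∀ s ∈ Set.Icc 0 T, IntegrableOn (fun x => (Dop i (fun y => f y s) x) ^ 2) (Ka a) :=
    fun i s hs => (hsl ((cf i).pow 2) s hs).congr_fun
      (fun x hx => by simp only [Pi.pow_apply]; rw [df i s hs x hx]) (measurable_Ka a)
  have jQ : ∀ i, ∀ s ∈ Set.Icc 0 T, IntegrableOn
      (fun x => Dop i (fun y => f y s) x * Dop i (fun y => u y s) x) (Ka a) :=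
    fun i s hs => (hsl ((cf i).mul (cU i)) s hs).congr_fun
      (fun x hx => by simp only [Pi.mul_apply]; rw [df i s hs x hx, dU i s hs x hx]) (measurable_Ka a)
  have jR : ∀ i, ∀ s ∈ Set.Icc 0 T, IntegrableOn
      (fun x => |Dop i (fun y => u y s) x| ^ (p i (x, s) + ρ)) (Ka a) :=
    fun i s hs => (hsl (cR i) s hs).congr_fun
      (fun x hx => by beta_reduce; rw [dU i s hs x hx]) (measurable_Ka a)
  -- bound of the energy
  obtain ⟨CE, hCE⟩ := (isCompact_cyl ha).exists_bound_of_continuousOn cE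
  have hEb : ∀ t ∈ Set.Icc 0 T, (∫ x in Ka a, ∑ i, (Dop i (fun y => u y t) x) ^ 2) ≤ CE * V := by
    intro t ht
    have h1 := norm_setIntegral_le_of_norm_le_const (μ := volume) (s := Ka a)
      (f := fun x => ∑ i, (Dop i (fun y => u y t) x) ^ 2) (C := CE) (vol_Ka_lt ha) (fun x hx => by
        have := hCE (x, t) ⟨subset_closure hx, ht⟩
        refine le_trans (le_of_eq ?_) this
        congr 1
        exact Finset.sum_congr rfl fun i _ => by rw [dU i t ht x hx])
    exact (le_abs_self _).trans h1
  have main := abs_energy (T := T) (m := m) (c1 := c1) (Eb := CE * V) hT hm hc1'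
    (E := fun s => ∫ x in Ka a, ∑ i, (Dop i (fun y => u y s) x) ^ 2)
    (W := fun s => ∑ i, ∑ j, ∫ x in Ka a,
      (ε ^ 2 + (Dop i (fun y => u y s) x) ^ 2) ^ ((p i (x, s) - 2) / 2) *
              (Dop i (Dop j (fun y => u y s)) x) ^ 2)
    (B := fun s => ∑ i, ∫ x in Ka a,
      Dop i (fun y => DZ a T (0, 1) U (y, s)) x * Dop i (fun y => u y s) x)
    (R := fun s => ∑ i, ∫ x in Ka a, (1 + |Dop i (fun y => u y s) x| ^ (p i (x, s) + ρ)))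
    (Q := fun s => ∑ i, ∫ x in Ka a, Dop i (fun y => f y s) x * Dop i (fun y => u y s) x)
    (Φ := fun s => ∫ x in Ka a, ∑ i, (Dop i (fun y => f y s) x) ^ 2)
    iE (integrable_finsetSum _ fun i _ => integrable_finsetSum _ fun j _ => iW i j)
    (integrable_finsetSum _ fun i _ => iB i) (integrable_finsetSum _ fun i _ => iR1 i) iΦ
    (fun s => Finset.sum_nonneg fun i _ => Finset.sum_nonneg fun j _ =>
      integral_nonneg fun x => by positivity)
    (fun s => Finset.sum_nonneg fun i _ => integral_nonneg fun x => by positivity)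
    (fun s => integral_nonneg fun x => by positivity)
    (fun s => integral_nonneg fun x => by positivity)
    (by
      intro s hs
      refine slice ha (P := fun i x => p i (x, s)) (M := M) hm hm1 hε.1 hρ.1 (hlog ε hε) ?_
        (fun i => hpx i s (hIcc hs)) (fun i x hx => hmM i (x, s) ⟨hx, hIcc hs⟩)
        (v := fun y => u y s) (g := fun y => DZ a T (0, 1) U (y, s)) (φ := fun y => f y s)
        (slice_smooth hu (hIcc hs)) (slice_smooth hut (hIcc hs)) (slice_smooth hf (hIcc hs))
        (fun x hx => hu0 x hx s (hIcc hs))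
        (fun x hx => time_zero hu hs (frontier_subset_closure hx) (fun t ht => hu0 x hx t ht))
        (fun x hx => hf0 s (hIcc hs) x hx) ?_
      · intro i
        obtain ⟨K, hK⟩ := hpLip i
        refine ⟨K, LipschitzOnWith.of_dist_le_mul fun x hx y hy => ?_⟩
        have := hK.dist_le_mul (x, s) ⟨hx, hIcc hs⟩ (y, s) ⟨hy, hIcc hs⟩
        simpa [Prod.dist_eq] using this
      · intro x hx
        rw [← hpde x hx s hs]
        exact (time_deriv hu hs (subset_closure hx)).deriv.symm)
    (by
      intro s hs
      have hs' := hIcc hs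
      beta_reduce
      rw [integral_finsetSum _ (fun i _ => jE i s hs'), integral_finsetSum _ (fun i _ => jΦ i s hs'),
        Finset.mul_sum, Finset.mul_sum, ← Finset.sum_add_distrib]
      refine Finset.sum_le_sum fun i _ => ?_
      rw [← integral_const_mul, ← integral_const_mul,
        ← integral_add ((jΦ i s hs').const_mul _) ((jE i s hs').const_mul _)]
      refine integral_mono (jQ i s hs') (((jΦ i s hs').const_mul _).add ((jE i s hs').const_mul _)) ?_
      intro x
      simp only [Pi.add_apply]
      set A := Dop i (fun y => f y s) x
      set B := Dop i (fun y => u y s) x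
      have : T * A ^ 2 + 1 / (4 * T) * B ^ 2 - A * B = 1 / (4 * T) * (2 * T * A - B) ^ 2 := by
        field_simp; ring
      have h2 : 0 ≤ 1 / (4 * T) * (2 * T * A - B) ^ 2 := by positivity
      linarith)
    (by
      intro t ht
      have hsub : Set.Ioo 0 t ⊆ Set.Ioo 0 T := Set.Ioo_subset_Ioo le_rfl ht.2
      beta_reduce
      rw [integral_finsetSum _ (fun i _ => (iB i).mono_set hsub),
        integral_finsetSum _ (fun i _ => jE i t ht), integral_finsetSum _ (fun i _ => jE i 0 h0T),
        ← Finset.sum_sub_distrib, Finset.mul_sum]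
      refine Finset.sum_congr rfl fun i _ => ?_
      have hq := ftc_slice ha hT (DZ_smooth ha hT (eX i) hu) ht
      have e1 : ∀ r ∈ Set.Icc 0 T, ∫ x in Ka a, (Dop i (fun y => u y r) x) ^ 2 =
          ∫ x in Ka a, (DZ a T (eX i) U (x, r)) ^ 2 := fun r hr =>
        setIntegral_congr_fun (measurable_Ka a) (fun x hx => by beta_reduce; rw [dU i r hr x hx])
      rw [e1 t ht, e1 0 h0T, ← hq]
      refine setIntegral_congr_fun measurableSet_Ioo fun s hs => ?_
      refine setIntegral_congr_fun (measurable_Ka a) fun x hx => ?_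
      beta_reduce
      rw [dU i s (hIcc (hsub hs)) x hx, dUt i s (hIcc (hsub hs)) x hx,
        DZ_symm (eX i) (0, 1) hu (hsub hs) hx])
    hEb
  intro t ht
  have hmain := main t (hIcc ht)
  beta_reduce at hmain
  rw [integral_finsetSum _ (fun i _ => integrable_finsetSum _ fun j _ => iW i j),
    integral_finsetSum _ (fun i _ => iR1 i)] at hmain
  have eW : ∀ i, ∫ s in Set.Ioo 0 T, ∑ j, ∫ x in Ka a,
      (ε ^ 2 + (Dop i (fun y => u y s) x) ^ 2) ^ ((p i (x, s) - 2) / 2) *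
              (Dop i (Dop j (fun y => u y s)) x) ^ 2 = ∑ j, ∫ s in Set.Ioo 0 T, ∫ x in Ka a,
      (ε ^ 2 + (Dop i (fun y => u y s) x) ^ 2) ^ ((p i (x, s) - 2) / 2) *
              (Dop i (Dop j (fun y => u y s)) x) ^ 2 := fun i =>
    integral_finsetSum _ (fun j _ => iW i j)
  simp only [eW] at hmain
  have eR : ∀ i, ∫ s in Set.Ioo 0 T, ∫ x in Ka a,
      (1 + |Dop i (fun y => u y s) x| ^ (p i (x, s) + ρ)) = T * V + ∫ s in Set.Ioo 0 T, ∫ x in Ka a,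
      |Dop i (fun y => u y s) x| ^ (p i (x, s) + ρ) := by
    intro i
    have h1 : ∫ s in Set.Ioo 0 T, ∫ x in Ka a,
        (1 + |Dop i (fun y => u y s) x| ^ (p i (x, s) + ρ)) = ∫ s in Set.Ioo 0 T, (V + ∫ x in Ka a,
        |Dop i (fun y => u y s) x| ^ (p i (x, s) + ρ)) := by
      refine setIntegral_congr_fun measurableSet_Ioo fun s hs => ?_
      beta_reduce
      have hc : Integrable (fun _ : Fin N → ℝ => (1 : ℝ)) (volume.restrict (Ka a)) :=
        integrableOn_const (vol_Ka_lt ha).ne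
      rw [integral_add hc (jR i s (hIcc hs))]
      simp [hV, Measure.real]
    have hc : Integrable (fun _ : ℝ => V) (volume.restrict (Set.Ioo 0 T)) :=
      integrableOn_const (by simp)
    rw [h1, integral_add hc (iR i)]
    simp [hT.le]
  simp only [eR, Finset.sum_add_distrib, Finset.sum_const, Finset.card_univ,
    Fintype.card_fin, nsmul_eq_mul] at hmain
  refine hmain.trans ?_
  rw [mul_assoc (4 + 4 / m) C2]
  refine mul_le_mul_of_nonneg_left ?_ (by positivity)
  have n1 : 0 ≤ ∫ x in Ka a, ∑ i, (Dop i (fun y => u y 0) x) ^ 2 :=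
    integral_nonneg fun x => by positivity
  have n2 : 0 ≤ ∫ s in Set.Ioo 0 T, ∫ x in Ka a, ∑ i, (Dop i (fun y => f y s) x) ^ 2 :=
    integral_nonneg fun s => integral_nonneg fun x => by positivity
  have n3 : 0 ≤ ∑ i, ∫ s in Set.Ioo 0 T, ∫ x in Ka a,
      |Dop i (fun y => u y s) x| ^ (p i (x, s) + ρ) :=
    Finset.sum_nonneg fun i _ => integral_nonneg fun s => integral_nonneg fun x => by positivity
  generalize (∫ x in Ka a, ∑ i, (Dop i (fun y => u y 0) x) ^ 2) = e0 at *
  generalize (∫ s in Set.Ioo 0 T, ∫ x in Ka a, ∑ i, (Dop i (fun y => f y s) x) ^ 2) = Φ0 at *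
  generalize (∑ i, ∫ s in Set.Ioo 0 T, ∫ x in Ka a,
      |Dop i (fun y => u y s) x| ^ (p i (x, s) + ρ)) = R0 at *
  have hK : 0 ≤ (N : ℝ) * (T * V) := by positivity
  have m1 : 0 ≤ c1 * (N * (T * V)) := by positivity
  rw [hC2]
  have k1 := mul_nonneg m1 n3
  have k2 := mul_nonneg m1 n1
  have k3 := mul_nonneg m1 n2
  have k4 := mul_nonneg hc1' n1
  have k5 := mul_nonneg hc1' n2
  have k6 := mul_nonneg hT.le n1
  have k7 := mul_nonneg hT.le n3
  nlinarith
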